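/- The limit as n → ∞ of n / log₂(F_{2n−1} + n) equals 1 / (2 log₂ φ), where F_m denotes the m-th Fibonacci number (F_1 = F_2 = 1) and φ = (1 + √5)/2 is the golden ratio. Consequently, the specificity score τ(T) = n / log₂(p(T) + n) of a rooted binary tree T with n leaves, whose total number of convex colorings is p(T) = F_{2n−1}, converges to 1/(2 log₂ φ) ≈ 0.72 as n → ∞. -/

import Mathlib

open Filter Topology in
theorem fib_bounds_aux (g : ℝ) (hg : 1 < g) (h2 : g ^ 2 = g + 1) (m : ℕ) :
    ((Nat.fib m : ℝ) ≤ g ^ m ∧ (Nat.fib (m + 1) : ℝ) ≤ g ^ (m + 1)) ∧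
    (g ^ (m + 1) ≤ g ^ 2 * Nat.fib (m + 1) ∧ g ^ (m + 2) ≤ g ^ 2 * Nat.fib (m + 2)) := by
  induction m with
  | zero =>
    simp
    constructor <;> nlinarith
  | succ k ih =>
    obtain ⟨⟨a, b⟩, c, d⟩ := ih
    have e1 : g ^ (k + 2) = g ^ (k + 1) + g ^ k := by
      rw [pow_add, h2]; ring
    have e2 : g ^ (k + 3) = g ^ (k + 2) + g ^ (k + 1) := by
      rw [pow_add g (k + 1) 2, h2]; ring
    refine ⟨⟨b, ?_⟩, d, ?_⟩
    · have : (Nat.fib (k + 2) : ℝ) = Nat.fib k + Nat.fib (k + 1) := by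
        exact_mod_cast Nat.fib_add_two
      show (Nat.fib (k + 2) : ℝ) ≤ g ^ (k + 2)
      linarith
    · have : (Nat.fib (k + 3) : ℝ) = Nat.fib (k + 1) + Nat.fib (k + 2) := by
        exact_mod_cast Nat.fib_add_two
      show g ^ (k + 3) ≤ g ^ 2 * (Nat.fib (k + 3) : ℝ)
      rw [this, mul_add]
      linarith

/-- `lim_{n → ∞} n / log₂(F_{2n-1} + n) = 1 / (2 log₂ φ)`,
where `F` is the Fibonacci sequence (`F_1 = F_2 = 1`) and `φ = (1 + √5)/2` is
the golden ratio.  Consequently the specificity score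
`τ(T) = n / log₂(p(T) + n)` of a rooted binary tree with `n` leaves, whose
total number of convex colorings is `p(T) = F_{2n-1}`, converges to
`1 / (2 log₂ φ) ≈ 0.72` as `n → ∞`. -/
theorem specificity_score_binary_tree_limit :
    Filter.Tendsto
      (fun n : ℕ => (n : ℝ) / Real.logb 2 ((Nat.fib (2 * n - 1) : ℝ) + n))
      Filter.atTop
      (nhds (1 / (2 * Real.logb 2 ((1 + Real.sqrt 5) / 2)))) := by
  have h5 : Real.sqrt 5 ^ 2 = 5 := Real.sq_sqrt (by norm_num)
  have h5' : 1 < Real.sqrt 5 := by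
    rw [Real.lt_sqrt] <;> norm_num
  generalize hgd : (1 + Real.sqrt 5) / 2 = g
  have hg : 1 < g := by rw [← hgd]; linarith
  have h2 : g ^ 2 = g + 1 := by rw [← hgd]; linarith
  have hg0 : 0 < g := by linarith
  clear hgd
  set L := Real.logb 2 g with hL
  have hLpos : 0 < L := Real.logb_pos (by norm_num) hg
  have key : ∀ n : ℕ, 1 ≤ n →
      2 * n * L - 3 * L ≤ Real.logb 2 ((Nat.fib (2 * n - 1) : ℝ) + n) ∧
      Real.logb 2 ((Nat.fib (2 * n - 1) : ℝ) + n) ≤ 2 * n * L + 1 := by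
    intro n hn
    obtain ⟨k, rfl⟩ : ∃ k, n = k + 1 := ⟨n - 1, by omega⟩
    have e : 2 * (k + 1) - 1 = 2 * k + 1 := by omega
    rw [e]
    obtain ⟨⟨-, b⟩, c, -⟩ := fib_bounds_aux g hg h2 (2 * k)
    have hn0 : (0 : ℝ) < ((k + 1 : ℕ) : ℝ) := by positivity
    have hf0 : (0 : ℝ) < (Nat.fib (2 * k + 1) : ℝ) := by
      exact_mod_cast Nat.fib_pos.2 (by omega)
    constructor
    · have h : g ^ (2 * k + 1) ≤ g ^ 2 * ((Nat.fib (2 * k + 1) : ℝ) + (k + 1 : ℕ)) := by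
        refine c.trans ?_
        gcongr
        linarith
      have := Real.logb_le_logb_of_le (b := 2) (by norm_num) (by positivity) h
      rw [Real.logb_mul (by positivity) (by positivity), Real.logb_pow, Real.logb_pow, ← hL] at this
      push_cast at this ⊢
      linarith
    · have hk : ((k + 1 : ℕ) : ℝ) ≤ g ^ (2 * (k + 1)) := by
        have h1 : ((k + 1 : ℕ) : ℝ) ≤ (2 : ℝ) ^ (k + 1) := by
          exact_mod_cast (Nat.lt_two_pow_self).le
        rw [pow_mul]
        refine h1.trans ?_
        gcongr
        linarith
      have hb : g ^ (2 * k + 1) ≤ g ^ (2 * (k + 1)) :=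
        pow_le_pow_right₀ hg.le (by omega)
      have h : (Nat.fib (2 * k + 1) : ℝ) + (k + 1 : ℕ) ≤ 2 * g ^ (2 * (k + 1)) := by linarith
      have := Real.logb_le_logb_of_le (b := 2) (by norm_num) (by positivity) h
      rw [Real.logb_mul (by positivity) (by positivity), Real.logb_pow, ← hL,
        Real.logb_self_eq_one (by norm_num)] at this
      push_cast at this ⊢
      linarith
  have hlim : Filter.Tendsto
      (fun n : ℕ => Real.logb 2 ((Nat.fib (2 * n - 1) : ℝ) + n) / n)
      Filter.atTop (nhds (2 * L)) := by
    have t1 : Filter.Tendsto (fun n : ℕ => 2 * L - 3 * L / (n : ℝ)) Filter.atTop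
        (nhds (2 * L)) := by
      simpa using (tendsto_const_div_atTop_nhds_zero_nat (3 * L)).const_sub (2 * L)
    have t2 : Filter.Tendsto (fun n : ℕ => 2 * L + 1 / (n : ℝ)) Filter.atTop
        (nhds (2 * L)) := by
      simpa using (tendsto_const_div_atTop_nhds_zero_nat (1 : ℝ)).const_add (2 * L)
    refine tendsto_of_tendsto_of_tendsto_of_le_of_le' t1 t2 ?_ ?_
    · filter_upwards [Filter.eventually_ge_atTop 1] with n hn
      have hn0 : (0 : ℝ) < n := by exact_mod_cast hn
      rw [le_div_iff₀ hn0, sub_mul, div_mul_cancel₀ _ hn0.ne']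
      linarith [(key n hn).1]
    · filter_upwards [Filter.eventually_ge_atTop 1] with n hn
      have hn0 : (0 : ℝ) < n := by exact_mod_cast hn
      rw [div_le_iff₀ hn0, add_mul, div_mul_cancel₀ _ hn0.ne']
      linarith [(key n hn).2]
  have := hlim.inv₀ (by positivity)
  simpa only [inv_div, one_div] using this
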